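/- Suppose (G_n) satisfies Assumption 1 and let Υ_n = T_mix(G_n)/|V_n|. Then, uniformly in distinct x, y ∈ V_n, P[H(x,y)] = 1/4 + o( Υ_n / log|V_n| ) + O( 1/|V_n| ) as n → ∞; that is, there exist a constant C > 0 and a sequence ε_n → 0 such that | P[H(x,y)] − 1/4 | ≤ ε_n · Υ_n / log|V_n| + C/|V_n| for all n and all distinct x, y ∈ V_n. -/

import Mathlib

open MeasureTheory ProbabilityTheory Filter

attribute [local instance] Classical.propDecidable

noncomputable section

namespace RWPaint

variable {V : Type*} [Fintype V]

/-- The degree of a vertex. -/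
def deg (G : SimpleGraph V) (x : V) : ℕ := (Finset.univ.filter fun y => G.Adj x y).card

/-- One-step transition kernel of the lazy random walk on a finite graph:
holding probability `1/2`, otherwise a uniformly chosen neighbour. -/
def K (G : SimpleGraph V) (x y : V) : ℝ :=
  if x = y then (if deg G x = 0 then 1 else 1 / 2)
  else if G.Adj x y then 1 / (2 * (deg G x : ℝ)) else 0

/-- The `t`-step transition kernel. -/
def Kpow (G : SimpleGraph V) : ℕ → V → V → ℝ
  | 0 => fun x y => if x = y then 1 else 0
  | t + 1 => fun x y => ∑ z, Kpow G t x z * K G z y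

/-- The uniform (stationary) probability of a single vertex. -/
def unif (V : Type*) [Fintype V] : ℝ := (Fintype.card V : ℝ)⁻¹

/-- The uniform mixing time. -/
def Tmix (G : SimpleGraph V) : ℕ :=
  sInf {t : ℕ | ∀ x y : V, |Kpow G t x y / unif V - 1| ≤ 1 / 4}

/-- The Green's function `g(x,y) = ∑_{t=0}^{Tmix} p^t(x,y)`. -/
def green (G : SimpleGraph V) (x y : V) : ℝ :=
  ∑ t ∈ Finset.range (Tmix G + 1), Kpow G t x y

/-- The kernel killed on (entering) the set `S`. -/
def Kkill (G : SimpleGraph V) (S : Finset V) (x y : V) : ℝ :=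
  if y ∈ S then 0 else K G x y

/-- Powers of the killed kernel. -/
def KkillPow (G : SimpleGraph V) (S : Finset V) : ℕ → V → V → ℝ
  | 0 => fun x y => if x = y then 1 else 0
  | t + 1 => fun x y => ∑ z, KkillPow G S t x z * Kkill G S z y

/-- `P_x[τ(S) ≤ T]`, the probability that the lazy walk started at `x` visits `S`
by time `T`. -/
def hitBy (G : SimpleGraph V) (S : Finset V) (x : V) (T : ℕ) : ℝ :=
  if x ∈ S then 1 else 1 - ∑ z, KkillPow G S T x z

/-- `f_{n,c}(x,y) = P_x[τ(y) ≤ c T_mix]`. -/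
def fnc (G : SimpleGraph V) (c : ℝ) (x y : V) : ℝ :=
  hitBy G {y} x ⌊c * (Tmix G : ℝ)⌋₊

/-- `f̄_{n,c} = ∑_y f_{n,c}(x,y) π(y)` (averaged also over `x`; by vertex
transitivity this agrees with the value for any fixed `x`). -/
def fbar (G : SimpleGraph V) (c : ℝ) : ℝ :=
  (∑ x : V, ∑ y : V, fnc G c x y) / (Fintype.card V : ℝ) ^ 2

/-- `F_{n,c} = ∑_{x,y} (f_{n,c}(x,y) - f̄_{n,c})^2`. -/
def Fquad (G : SimpleGraph V) (c : ℝ) : ℝ :=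
  ∑ x : V, ∑ y : V, (fnc G c x y - fbar G c) ^ 2

/-- `Γ_n = c₀ T_mix log |V|`. -/
def gammaTime (G : SimpleGraph V) (c₀ : ℝ) : ℕ :=
  ⌊c₀ * (Tmix G : ℝ) * Real.log (Fintype.card V)⌋₊

/-- `P_x[X_t = z | τ(y) ≥ t]` as a combinatorial formula (meaningful for
`x ≠ y` and `t ≥ 1`). -/
def condAtProb (G : SimpleGraph V) (y x z : V) (t : ℕ) : ℝ :=
  (∑ w, KkillPow G {y} (t - 1) x w * K G w z) / (∑ w, KkillPow G {y} (t - 1) x w)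

/-- `∑_{t=0}^{c T_mix} p^t(x,y)`. -/
def greenC (G : SimpleGraph V) (c : ℝ) (x y : V) : ℝ :=
  ∑ t ∈ Finset.range (⌊c * (Tmix G : ℝ)⌋₊ + 1), Kpow G t x y

/-- A graph is vertex transitive if its automorphism group acts transitively. -/
def IsVertexTransitive (G : SimpleGraph V) : Prop :=
  ∀ x y : V, ∃ e : G ≃g G, e x = y

/-- The probability of a trajectory prefix for the lazy walk with initial
distribution `init`. -/
def walkP (G : SimpleGraph V) (init : V → ℝ) (n : ℕ) (v : ℕ → V) : ℝ :=
  init (v 0) * ∏ i ∈ Finset.range n, K G (v i) (v (i + 1))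

/-- Point mass initial distribution. -/
def delta (x : V) : V → ℝ := fun y => if y = x then 1 else 0

/-- Uniform initial distribution. -/
def uinit (V : Type*) [Fintype V] : V → ℝ := fun _ => (Fintype.card V : ℝ)⁻¹

/-- `X₁, X₂` are independent lazy random walks on `G` with initial
distributions `init₁, init₂`, defined on the probability space `(Ω, P)`:
all finite-dimensional distributions factorize as products of trajectory-prefix
probabilities. -/
structure IsWalkPair {Ω : Type*} [MeasurableSpace Ω] (G : SimpleGraph V) (P : Measure Ω)
    (X₁ X₂ : ℕ → Ω → V) (init₁ init₂ : V → ℝ) : Prop where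
  meas₁ : ∀ (t : ℕ) (x : V), MeasurableSet {ω | X₁ t ω = x}
  meas₂ : ∀ (t : ℕ) (x : V), MeasurableSet {ω | X₂ t ω = x}
  law : ∀ (n : ℕ) (v w : ℕ → V),
    (P {ω | (∀ i ≤ n, X₁ i ω = v i) ∧ ∀ i ≤ n, X₂ i ω = w i}).toReal
      = walkP G init₁ n v * walkP G init₂ n w

/-- `X₁, X₂` are independent stationary lazy random walks on `G`, together with
a family `ξ` of independent fair coins (one per vertex, used to break ties),
all defined on the probability space `(Ω, P)`. -/
structure IsPaintSetup {Ω : Type*} [MeasurableSpace Ω] (G : SimpleGraph V) (P : Measure Ω)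
    (X₁ X₂ : ℕ → Ω → V) (ξ : V → Ω → Bool) : Prop where
  meas₁ : ∀ (t : ℕ) (x : V), MeasurableSet {ω | X₁ t ω = x}
  meas₂ : ∀ (t : ℕ) (x : V), MeasurableSet {ω | X₂ t ω = x}
  measξ : ∀ x : V, MeasurableSet {ω | ξ x ω = true}
  law : ∀ (n : ℕ) (v w : ℕ → V) (b : V → Bool),
    (P {ω | ((∀ i ≤ n, X₁ i ω = v i) ∧ ∀ i ≤ n, X₂ i ω = w i) ∧ ∀ x, ξ x ω = b x}).toReal
      = walkP G (uinit V) n v * walkP G (uinit V) n w * (1 / 2) ^ Fintype.card V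

/-- The hitting time `τ(x)` of a vertex `x` (with value `⊤` if `x` is never visited). -/
def hitTime {Ω : Type*} (X : ℕ → Ω → V) (x : V) (ω : Ω) : ℕ∞ :=
  ⨅ (s : ℕ) (_ : X s ω = x), (s : ℕ∞)

/-- `τ(x,y) = τ(x) ⊓ τ(y)`. -/
def hitTime2 {Ω : Type*} (X : ℕ → Ω → V) (x y : V) (ω : Ω) : ℕ∞ :=
  min (hitTime X x ω) (hitTime X y ω)

/-- `|𝒜₁|`: the number of vertices first visited by `X₁` (ties broken by the coins `ξ`). -/
def paintedCount {Ω : Type*} (X₁ X₂ : ℕ → Ω → V) (ξ : V → Ω → Bool) (ω : Ω) : ℕ :=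
  Nat.card {x : V // hitTime X₁ x ω < hitTime X₂ x ω ∨
    (hitTime X₁ x ω = hitTime X₂ x ω ∧ ξ x ω = true)}

/-- The event `H(x,y) = {τ₁(x) < min(τ₁(y), τ₂(x), τ₂(y))}`. -/
def Hevent {Ω : Type*} (X₁ X₂ : ℕ → Ω → V) (x y : V) : Set Ω :=
  {ω | hitTime X₁ x ω < min (hitTime X₁ y ω) (min (hitTime X₂ x ω) (hitTime X₂ y ω))}

/-- `Y₂ = X₂(τ₁(x,y))`. -/
def Ytwo {Ω : Type*} (X₁ X₂ : ℕ → Ω → V) (x y : V) (ω : Ω) : V :=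
  X₂ (hitTime2 X₁ x y ω).toNat ω

/-- `π̃(z;x,y) = P[X₂(τ₁(x,y)) = z | H(x,y)]`. -/
def pitilde {Ω : Type*} [MeasurableSpace Ω] (P : Measure Ω) (X₁ X₂ : ℕ → Ω → V) (x y z : V) : ℝ :=
  (P (Hevent X₁ X₂ x y ∩ {ω | Ytwo X₁ X₂ x y ω = z})).toReal
    / (P (Hevent X₁ X₂ x y)).toReal

/-- The event `A(x,y) = {τ₁(x,y) ≥ τ₂(x,y) > τ₁(x,y) - Γ, τ₁(x) < τ₁(y)}`. -/
def Aevent {Ω : Type*} (X₁ X₂ : ℕ → Ω → V) (x y : V) (Γ : ℕ) : Set Ω :=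
  {ω | hitTime2 X₂ x y ω ≤ hitTime2 X₁ x y ω ∧
    hitTime2 X₁ x y ω - (Γ : ℕ∞) < hitTime2 X₂ x y ω ∧
    hitTime X₁ x ω < hitTime X₁ y ω}

/-- Conditional probability `P[A | B]`. -/
def condGiven {Ω : Type*} [MeasurableSpace Ω] (P : Measure Ω) (A B : Set Ω) : ℝ :=
  (P (A ∩ B)).toReal / (P B).toReal

/-- Assumption 1 of the paper. -/
structure Assumption1 (V : ℕ → Type*) [∀ n, Fintype (V n)]
    (G : ∀ n, SimpleGraph (V n)) : Prop where
  conn : ∀ n, (G n).Connected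
  vt : ∀ n, IsVertexTransitive (G n)
  card_top : Tendsto (fun n => Fintype.card (V n)) atTop atTop
  tmix_small : Tendsto (fun n =>
    (Tmix (G n) : ℝ) * (Real.log (Fintype.card (V n))) ^ 2 / (Fintype.card (V n) : ℝ))
    atTop (nhds 0)
  tmix_top : Tendsto (fun n => Tmix (G n)) atTop atTop
  green_sq_small : ∃ ε : ℕ → ℝ, Tendsto ε atTop (nhds 0) ∧
    ∀ n, ∀ x : V n, ∑ y ∈ Finset.univ.erase x, (green (G n) x y) ^ 2
      ≤ ε n * (Tmix (G n) : ℝ) / Real.log (Fintype.card (V n))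
  hit_miss : ∃ ρ : ℝ, ρ < 1 ∧ ∀ n, ∀ x y z : V n, x ≠ y → x ≠ z → y ≠ z →
    hitBy (G n) {y, z} x (Tmix (G n)) ≤ ρ

/-- The discrete torus `ℤ_n^d`. -/
def torus (d n : ℕ) : SimpleGraph (Fin d → ZMod n) where
  Adj x y := x ≠ y ∧ ∃ i, y - x = Pi.single i 1 ∨ x - y = Pi.single i 1
  symm := by
    constructor
    rintro x y ⟨hne, i, h | h⟩
    · exact ⟨hne.symm, i, Or.inr h⟩
    · exact ⟨hne.symm, i, Or.inl h⟩
  loopless := ⟨fun x h => h.1 rfl⟩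

/-- The hypercube `ℤ_2^n`. -/
def hypercube (n : ℕ) : SimpleGraph (Fin n → Bool) where
  Adj x y := x ≠ y ∧ ∃ i, ∀ j, j ≠ i → x j = y j
  symm := by
    constructor
    rintro x y ⟨hne, i, h⟩
    exact ⟨hne.symm, i, fun j hj => (h j hj).symm⟩
  loopless := ⟨fun x h => h.1 rfl⟩

/-- The Cayley graph of the symmetric group `S_n` generated by the transpositions. -/
def transpositionGraph (n : ℕ) : SimpleGraph (Equiv.Perm (Fin n)) where
  Adj σ τ := (σ * τ⁻¹).IsSwap
  symm := by
    constructor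
    rintro σ τ ⟨a, b, hab, h⟩
    exact ⟨a, b, hab, by rw [show τ * σ⁻¹ = (σ * τ⁻¹)⁻¹ by group, h, Equiv.swap_inv]⟩
  loopless := by
    constructor
    intro σ h
    obtain ⟨a, b, hab, h⟩ := h
    rw [mul_inv_cancel] at h
    exact hab (by simpa [Equiv.swap_apply_left] using Equiv.ext_iff.mp h a)

/-- One-step kernel of the lazy simple random walk on `ℤ^d`. -/
def KZ (d : ℕ) (x y : Fin d → ℤ) : ℝ :=
  if x = y then 1 / 2
  else if ∃ i, y - x = Pi.single i 1 ∨ x - y = Pi.single i 1 then 1 / (4 * d) else 0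

/-- `t`-step kernel of the lazy simple random walk on `ℤ^d`. -/
def KZpow (d : ℕ) : ℕ → (Fin d → ℤ) → (Fin d → ℤ) → ℝ
  | 0 => fun x y => if x = y then 1 else 0
  | t + 1 => fun x y => ∑' z, KZpow d t x z * KZ d z y

/-- The Green's function `G(x; ℤ^d) = ∑_{t=0}^∞ p^t(0,x)` of the lazy walk on `ℤ^d`. -/
def greenZ (d : ℕ) (x : Fin d → ℤ) : ℝ := ∑' t : ℕ, KZpow d t 0 x

/-- `α_d` for `d ≥ 5`. -/
def alphaHigh (d : ℕ) : ℝ := (∑' y : Fin d → ℤ, (greenZ d y) ^ 2) / (greenZ d 0) ^ 2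

/-- The normalization `h_d(n)`. -/
def hfun (d n : ℕ) : ℝ :=
  if d = 3 then (n : ℝ) ^ 4
  else if d = 4 then (n : ℝ) ^ 4 * Real.log n
  else (n : ℝ) ^ d

/-- Matrix powers of an abstract kernel. -/
def mpow (p : V → V → ℝ) : ℕ → V → V → ℝ
  | 0 => fun x y => if x = y then 1 else 0
  | t + 1 => fun x y => ∑ z, mpow p t x z * p z y

/-- Total variation distance between two (probability) vectors. -/
def tvDist (μ ν : V → ℝ) : ℝ := (1 / 2) * ∑ x, |μ x - ν x|


section Helpers

variable {V : Type} [Fintype V]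

theorem deg_const (G : SimpleGraph V) (hv : IsVertexTransitive G) (x y : V) : deg G x = deg G y := by
  obtain ⟨e, rfl⟩ := hv x y
  unfold deg
  refine Finset.card_bij (fun a _ => e a) ?_ ?_ ?_
  · intro a ha
    simp only [Finset.mem_filter, Finset.mem_univ, true_and] at ha ⊢
    exact e.map_adj_iff.mpr ha
  · intro a _ b _ h
    exact e.injective h
  · intro b hb
    refine ⟨e.symm b, ?_, by simp⟩
    have : G.Adj (e x) (e (e.symm b)) := by simpa using hb
    simp only [Finset.mem_filter, Finset.mem_univ, true_and]
    exact e.map_adj_iff.mp this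

theorem K_symm (G : SimpleGraph V) (hv : IsVertexTransitive G) (x y : V) : K G x y = K G y x := by
  unfold K
  rw [deg_const G hv x y]
  by_cases h : x = y
  · subst h; rfl
  · simp [h, Ne.symm h, G.adj_comm x y]

theorem K_auto (G : SimpleGraph V) (hv : IsVertexTransitive G) (e : G ≃g G) (x y : V) :
    K G (e x) (e y) = K G x y := by
  unfold K
  rw [deg_const G hv (e x) x]
  have h : G.Adj (e x) (e y) ↔ G.Adj x y := e.map_adj_iff
  simp [e.injective.eq_iff, h]

theorem K_nonneg (G : SimpleGraph V) (x y : V) : 0 ≤ K G x y := by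
  unfold K
  split_ifs <;> positivity

theorem K_pos (G : SimpleGraph V) (x y : V) (h : G.Adj x y) : 0 < K G x y := by
  unfold K
  have hd : 0 < deg G x := Finset.card_pos.mpr ⟨y, by simpa using h⟩
  rw [if_neg h.ne, if_pos h]
  positivity

theorem K_row (G : SimpleGraph V) (x : V) : ∑ y, K G x y = 1 := by
  have h1 : ∀ y, K G x y = (if x = y then (if deg G x = 0 then 1 else 1 / 2) else 0)
      + (if G.Adj x y then 1 / (2 * (deg G x : ℝ)) else 0) := by
    intro y
    unfold K
    by_cases h : x = y
    · subst h; simp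
    · simp [h]
  simp_rw [h1]
  rw [Finset.sum_add_distrib, Finset.sum_ite_eq, ← Finset.sum_filter, Finset.sum_const]
  have : (Finset.univ.filter fun y => G.Adj x y).card = deg G x := rfl
  rw [this]
  by_cases h : deg G x = 0
  · simp [h]
  · simp [h]; field_simp; norm_num

theorem K_col (G : SimpleGraph V) (hv : IsVertexTransitive G) (x : V) : ∑ y, K G y x = 1 := by
  rw [← K_row G x]
  exact Finset.sum_congr rfl fun y _ => K_symm G hv y x

theorem Kpow_eq (G : SimpleGraph V) (t : ℕ) : (Matrix.of (Kpow G t)) = (Matrix.of (K G)) ^ t := by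
  induction t with
  | zero => ext i j; simp [Kpow, Matrix.one_apply]
  | succ t ih => rw [pow_succ, ← ih]; ext i j; simp [Kpow, Matrix.mul_apply]

theorem Kpow_symm (G : SimpleGraph V) (hv : IsVertexTransitive G) (t : ℕ) (x y : V) :
    Kpow G t x y = Kpow G t y x := by
  have h1 : (Matrix.of (K G)).transpose = Matrix.of (K G) := by
    ext i j; exact K_symm G hv j i
  have h : (Matrix.of (Kpow G t)).transpose = Matrix.of (Kpow G t) := by
    rw [Kpow_eq, Matrix.transpose_pow, h1]
  exact congrFun (congrFun h y) x

theorem Kpow_auto (G : SimpleGraph V) (hv : IsVertexTransitive G) (e : G ≃g G) (t : ℕ) (x y : V) :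
    Kpow G t (e x) (e y) = Kpow G t x y := by
  induction t generalizing y with
  | zero => simp [Kpow, e.injective.eq_iff]
  | succ t ih =>
    simp only [Kpow]
    rw [← Equiv.sum_comp e.toEquiv]
    refine Finset.sum_congr rfl fun z _ => ?_
    have : e.toEquiv z = e z := rfl
    rw [this, ih, K_auto G hv]

theorem Kpow_diag (G : SimpleGraph V) (hv : IsVertexTransitive G) (t : ℕ) (x y : V) :
    Kpow G t x x = Kpow G t y y := by
  obtain ⟨e, rfl⟩ := hv x y
  rw [Kpow_auto G hv]

/-- `BB t z = P[τ(S) ≥ t, X_t = z]`. -/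
def BB (G : SimpleGraph V) (S : Finset V) : ℕ → V → ℝ
  | 0 => fun _ => (Fintype.card V : ℝ)⁻¹
  | t + 1 => fun z => ∑ w ∈ Sᶜ, BB G S t w * K G w z

theorem BB_nonneg (G : SimpleGraph V) (S : Finset V) (t : ℕ) (z : V) : 0 ≤ BB G S t z := by
  induction t generalizing z with
  | zero => simp [BB]
  | succ t ih => exact Finset.sum_nonneg fun w _ => mul_nonneg (ih w) (K_nonneg G w z)

theorem BB_anti (G : SimpleGraph V) (hv : IsVertexTransitive G) (S : Finset V) (t : ℕ) (z : V) :
    BB G S (t + 1) z ≤ BB G S t z := by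
  induction t generalizing z with
  | zero =>
    simp only [BB]
    calc ∑ w ∈ Sᶜ, (Fintype.card V : ℝ)⁻¹ * K G w z
        ≤ ∑ w, (Fintype.card V : ℝ)⁻¹ * K G w z :=
          Finset.sum_le_sum_of_subset_of_nonneg (Finset.subset_univ _)
            fun w _ _ => mul_nonneg (by positivity) (K_nonneg G w z)
      _ = _ := by rw [← Finset.mul_sum, K_col G hv, mul_one]
  | succ t ih =>
    exact Finset.sum_le_sum fun w _ => mul_le_mul_of_nonneg_right (ih w) (K_nonneg G w z)

theorem BB_antitone (G : SimpleGraph V) (hv : IsVertexTransitive G) (S : Finset V) (z : V) :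
    Antitone fun t => BB G S t z := antitone_nat_of_succ_le fun t => BB_anti G hv S t z

theorem BB_le (G : SimpleGraph V) (hv : IsVertexTransitive G) (S : Finset V) (t : ℕ) (z : V) :
    BB G S t z ≤ (Fintype.card V : ℝ)⁻¹ := BB_antitone G hv S z (Nat.zero_le t)

theorem BB_renewal (G : SimpleGraph V) (hv : IsVertexTransitive G) (S : Finset V) (t : ℕ) (z : V) :
    (Fintype.card V : ℝ)⁻¹ = BB G S t z
      + ∑ s ∈ Finset.range t, ∑ a ∈ S, BB G S s a * Kpow G (t - s) a z := by
  induction t generalizing z with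
  | zero => simp [BB]
  | succ t ih =>
    have h1 : (Fintype.card V : ℝ)⁻¹ = ∑ w, (Fintype.card V : ℝ)⁻¹ * K G w z := by
      rw [← Finset.mul_sum, K_col G hv, mul_one]
    rw [h1, Finset.sum_congr rfl fun w _ => by rw [ih w]]
    simp_rw [add_mul]
    rw [Finset.sum_add_distrib, ← Finset.sum_compl_add_sum S, Finset.sum_range_succ]
    have h2 : ∑ w, (∑ s ∈ Finset.range t, ∑ a ∈ S, BB G S s a * Kpow G (t - s) a w) * K G w z
        = ∑ s ∈ Finset.range t, ∑ a ∈ S, BB G S s a * Kpow G (t + 1 - s) a z := by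
      simp_rw [Finset.sum_mul]
      rw [Finset.sum_comm]
      refine Finset.sum_congr rfl fun s hs => ?_
      rw [Finset.sum_comm]
      refine Finset.sum_congr rfl fun a _ => ?_
      have : t + 1 - s = (t - s) + 1 := by
        have := Finset.mem_range.mp hs; omega
      rw [this]
      simp only [Kpow]
      rw [Finset.mul_sum]
      exact Finset.sum_congr rfl fun w _ => mul_assoc _ _ _
    have h3 : ∀ a, Kpow G (t + 1 - t) a z = K G a z := by
      intro a
      have : t + 1 - t = 0 + 1 := by omega
      rw [this]
      simp [Kpow]
    rw [h2]
    simp_rw [h3]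
    simp only [BB]
    ring

theorem BB_eq (G : SimpleGraph V) (hv : IsVertexTransitive G) (x y : V) (hxy : x ≠ y) (t : ℕ) :
    BB G {x, y} t x = BB G {x, y} t y := by
  induction t using Nat.strong_induction_on with
  | _ t ih =>
    have hx := BB_renewal G hv {x, y} t x
    have hy := BB_renewal G hv {x, y} t y
    have : ∑ s ∈ Finset.range t, ∑ a ∈ {x, y}, BB G {x, y} s a * Kpow G (t - s) a x
        = ∑ s ∈ Finset.range t, ∑ a ∈ {x, y}, BB G {x, y} s a * Kpow G (t - s) a y := by
      refine Finset.sum_congr rfl fun s hs => ?_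
      rw [Finset.sum_pair hxy, Finset.sum_pair hxy, ih s (Finset.mem_range.mp hs),
        Kpow_diag G hv _ x y, Kpow_symm G hv _ y x]
      ring
    linarith

/-- survival probability -/
def QQ (G : SimpleGraph V) (S : Finset V) (t : ℕ) : ℝ := ∑ z ∈ Sᶜ, BB G S t z

theorem QQ_succ (G : SimpleGraph V) (S : Finset V) (t : ℕ) :
    QQ G S t = QQ G S (t + 1) + ∑ a ∈ S, BB G S (t + 1) a := by
  unfold QQ
  rw [Finset.sum_compl_add_sum]
  simp only [BB]
  rw [Finset.sum_comm]
  refine Finset.sum_congr rfl fun w _ => ?_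
  rw [← Finset.mul_sum, K_row, mul_one]

theorem QQ_zero (G : SimpleGraph V) [Nonempty V] (S : Finset V) :
    1 = QQ G S 0 + ∑ a ∈ S, BB G S 0 a := by
  unfold QQ
  rw [Finset.sum_compl_add_sum]
  simp [BB]

theorem BB_tendsto (G : SimpleGraph V) (hc : G.Connected) (hv : IsVertexTransitive G)
    (S : Finset V) (x : V) (hx : x ∈ S) : Tendsto (QQ G S) atTop (nhds 0) := by
  have hlim : ∀ z, ∃ l, Tendsto (fun t => BB G S t z) atTop (nhds l) := fun z =>
    ⟨_, tendsto_atTop_ciInf (BB_antitone G hv S z) ⟨0, by rintro _ ⟨t, rfl⟩; exact BB_nonneg G S t z⟩⟩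
  choose L hL using hlim
  have hL0 : ∀ z, 0 ≤ L z := fun z => ge_of_tendsto' (hL z) fun t => BB_nonneg G S t z
  have hrec : ∀ z, L z = ∑ w ∈ Sᶜ, L w * K G w z := by
    intro z
    refine tendsto_nhds_unique ((tendsto_add_atTop_iff_nat 1).mpr (hL z)) ?_
    simp only [BB]
    exact tendsto_finsetSum _ fun w _ => (hL w).mul_const _
  set A : V → ℝ := fun z => if z ∈ S then 0 else L z with hA
  have hA0 : ∀ z, 0 ≤ A z := by intro z; simp only [hA]; split_ifs; exacts [le_rfl, hL0 z]
  have hrecA : ∀ z, z ∉ S → A z = ∑ w, A w * K G w z := by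
    intro z hz
    rw [← Finset.sum_compl_add_sum S]
    have : ∑ w ∈ S, A w * K G w z = 0 := Finset.sum_eq_zero fun w hw => by simp [hA, hw]
    rw [this, add_zero]
    simp only [hA, hz, if_false]
    rw [hrec z]
    refine Finset.sum_congr rfl fun w hw => ?_
    rw [if_neg (Finset.mem_compl.mp hw)]
  haveI : Nonempty V := ⟨x⟩
  obtain ⟨m, hm⟩ := Finite.exists_max A
  have hAx : A x = 0 := by simp [hA, hx]
  have hM : A m = 0 := by
    by_contra hne
    have hpos : 0 < A m := lt_of_le_of_ne (hA0 m) (Ne.symm hne)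
    have hstep : ∀ u v, G.Adj u v → A u = A m → A v = A m := by
      intro u v huv hu
      have huS : u ∉ S := by
        intro h
        have : A u = 0 := by simp [hA, h]
        linarith
      have h1 : ∑ w, (A m - A w) * K G w u = 0 := by
        simp_rw [sub_mul]
        rw [Finset.sum_sub_distrib, ← Finset.mul_sum, K_col G hv, ← hrecA u huS, hu]; ring
      rw [Finset.sum_eq_zero_iff_of_nonneg
        (fun w _ => mul_nonneg (sub_nonneg.mpr (hm w)) (K_nonneg G w u))] at h1
      have h2 := h1 v (Finset.mem_univ v)
      have h3 := K_pos G v u huv.symm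
      rcases mul_eq_zero.mp h2 with h | h
      · linarith
      · linarith
    have hall : ∀ u v, G.Reachable u v → A u = A m → A v = A m := by
      rintro u v ⟨p⟩
      induction p with
      | nil => exact id
      | cons h _ ih => exact fun hu => ih (hstep _ _ h hu)
    have := hall m x (hc.preconnected m x) rfl
    linarith
  have hLz : ∀ z ∈ Sᶜ, L z = 0 := by
    intro z hz
    have h1 := hm z
    have h2 := hA0 z
    simp only [hA] at h1 h2
    rw [if_neg (Finset.mem_compl.mp hz)] at h1 h2
    simp only [hA] at hM
    linarith
  have := tendsto_finsetSum Sᶜ fun z (_ : z ∈ Sᶜ) => hL z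
  rw [Finset.sum_eq_zero hLz] at this
  exact this

theorem partial_id (G : SimpleGraph V) (hv : IsVertexTransitive G) (x y : V) (hxy : x ≠ y) (N : ℕ) :
    ∑ t ∈ Finset.range (N + 1), BB G {x, y} t x * QQ G {x, y} t
      = (1 - QQ G {x, y} N ^ 2) / 4 - ∑ t ∈ Finset.range (N + 1), BB G {x, y} t x ^ 2
    ∧ ∑ t ∈ Finset.range (N + 1), BB G {x, y} t x = (1 - QQ G {x, y} N) / 2 := by
  haveI : Nonempty V := ⟨x⟩
  induction N with
  | zero =>
    have h := QQ_zero G {x, y}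
    rw [Finset.sum_pair hxy, ← BB_eq G hv x y hxy] at h
    have h' : BB G {x, y} 0 x = (1 - QQ G {x, y} 0) / 2 := by linarith
    simp only [zero_add, Finset.sum_range_one]
    rw [h']
    constructor <;> ring
  | succ N ih =>
    have h := QQ_succ G {x, y} N
    rw [Finset.sum_pair hxy, ← BB_eq G hv x y hxy] at h
    have h' : BB G {x, y} (N + 1) x = (QQ G {x, y} N - QQ G {x, y} (N + 1)) / 2 := by linarith
    rw [Finset.sum_range_succ, Finset.sum_range_succ _ (N + 1), Finset.sum_range_succ _ (N + 1),
      ih.1, ih.2, h']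
    constructor <;> ring

theorem QQ_nonneg (G : SimpleGraph V) (S : Finset V) (t : ℕ) : 0 ≤ QQ G S t :=
  Finset.sum_nonneg fun _ _ => BB_nonneg _ _ _ _

theorem limit_bound (G : SimpleGraph V) (hc : G.Connected) (hv : IsVertexTransitive G)
    (x y : V) (hxy : x ≠ y) (p : ℝ)
    (hp : HasSum (fun t => BB G {x, y} t x * QQ G {x, y} t) p) :
    |p - 1 / 4| ≤ 1 / (Fintype.card V : ℝ) := by
  have h1 := (tendsto_add_atTop_iff_nat 1).mpr hp.tendsto_sum_nat
  have hQ := BB_tendsto G hc hv {x, y} x (by simp)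
  have h2 : Tendsto (fun N => (∑ t ∈ Finset.range (N + 1), BB G {x, y} t x * QQ G {x, y} t)
      - (1 - QQ G {x, y} N ^ 2) / 4) atTop (nhds (p - (1 - 0 ^ 2) / 4)) :=
    h1.sub (((tendsto_const_nhds).sub (hQ.pow 2)).div_const 4)
  have e : p - (1 - 0 ^ 2) / 4 = p - 1 / 4 := by ring
  rw [e] at h2
  refine le_of_tendsto' h2.abs fun N => ?_
  obtain ⟨ha, hb⟩ := partial_id G hv x y hxy N
  rw [ha]
  have h3 : 0 ≤ ∑ t ∈ Finset.range (N + 1), BB G {x, y} t x ^ 2 :=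
    Finset.sum_nonneg fun _ _ => sq_nonneg _
  have h4 : ∑ t ∈ Finset.range (N + 1), BB G {x, y} t x ^ 2
      ≤ (Fintype.card V : ℝ)⁻¹ * ∑ t ∈ Finset.range (N + 1), BB G {x, y} t x := by
    rw [Finset.mul_sum]
    refine Finset.sum_le_sum fun t _ => ?_
    rw [sq]
    exact mul_le_mul_of_nonneg_right (BB_le G hv _ t x) (BB_nonneg _ _ _ _)
  rw [hb] at h4
  have h5 := QQ_nonneg G {x, y} N
  have h6 : (0:ℝ) ≤ (Fintype.card V : ℝ)⁻¹ := by positivity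
  have h7 : (Fintype.card V : ℝ)⁻¹ * ((1 - QQ G {x, y} N) / 2) ≤ (Fintype.card V : ℝ)⁻¹ := by
    nlinarith
  rw [one_div, abs_le]
  constructor <;> linarith

variable {Ω : Type} [MeasurableSpace Ω]

/-- Both walks avoid `S` before time `t`, and sit at `z`, `w` at time `t`. -/
def EE (S : Finset V) (X₁ X₂ : ℕ → Ω → V) (t : ℕ) (z w : V) : Set Ω :=
  {ω | (∀ i < t, X₁ i ω ∉ S ∧ X₂ i ω ∉ S) ∧ X₁ t ω = z ∧ X₂ t ω = w}

theorem meas_pred₁ {X : ℕ → Ω → V} (h : ∀ (t : ℕ) (x : V), MeasurableSet {ω | X t ω = x})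
    (t : ℕ) (A : Set V) : MeasurableSet {ω | X t ω ∈ A} := by
  have : {ω | X t ω ∈ A} = ⋃ x ∈ A, {ω | X t ω = x} := by ext; simp
  rw [this]
  exact MeasurableSet.biUnion A.to_countable fun x _ => h t x

theorem EE_meas {G : SimpleGraph V} {P : Measure Ω} {X₁ X₂ : ℕ → Ω → V} {i₁ i₂ : V → ℝ}
    (h : IsWalkPair G P X₁ X₂ i₁ i₂) (S : Finset V) (t : ℕ) (z w : V) :
    MeasurableSet (EE S X₁ X₂ t z w) := by
  have : EE S X₁ X₂ t z w = (⋂ i ∈ Set.Iio t, ({ω | X₁ i ω ∈ ((S : Set V)ᶜ)} ∩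
      {ω | X₂ i ω ∈ ((S : Set V)ᶜ)})) ∩ ({ω | X₁ t ω = z} ∩ {ω | X₂ t ω = w}) := by
    ext ω; simp [EE]
  rw [this]
  refine MeasurableSet.inter (MeasurableSet.biInter (Set.to_countable _) fun i _ => ?_)
    ((h.meas₁ t z).inter (h.meas₂ t w))
  exact (meas_pred₁ h.meas₁ i _).inter (meas_pred₁ h.meas₂ i _)

/-- Decompose a measure along a finite-valued function with measurable fibres. -/
theorem measure_decomp {ι : Type} [Fintype ι] (P : Measure Ω) [IsProbabilityMeasure P]
    (f : Ω → ι) (hf : ∀ i, MeasurableSet {ω | f ω = i}) (A : Set Ω) (hA : MeasurableSet A) :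
    P.real A = ∑ i, P.real (A ∩ {ω | f ω = i}) := by
  have : A = ⋃ i ∈ (Finset.univ : Finset ι), (A ∩ {ω | f ω = i}) := by ext; simp
  conv_lhs => rw [this]
  refine measureReal_biUnion_finset ?_ fun i _ => hA.inter (hf i)
  intro i _ j _ hij
  refine Set.disjoint_left.mpr ?_
  rintro ω ⟨_, h1⟩ ⟨_, h2⟩
  exact hij (h1.symm.trans h2)

theorem EE_markov {G : SimpleGraph V} {P : Measure Ω} [IsProbabilityMeasure P]
    {X₁ X₂ : ℕ → Ω → V} {i₁ i₂ : V → ℝ}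
    (h : IsWalkPair G P X₁ X₂ i₁ i₂) (S : Finset V) (t : ℕ) (z w z' w' : V) :
    P.real (EE S X₁ X₂ t z w ∩ {ω | X₁ (t + 1) ω = z' ∧ X₂ (t + 1) ω = w'})
      = P.real (EE S X₁ X₂ t z w) * (K G z z' * K G w w') := by
  let f : Ω → (Fin (t + 1) → V) × (Fin (t + 1) → V) := fun ω =>
    (fun i => X₁ i ω, fun i => X₂ i ω)
  have hf : ∀ i, MeasurableSet {ω | f ω = i} := by
    rintro ⟨a, b⟩
    have : {ω | f ω = (a, b)} = ⋂ i, ({ω | X₁ (i : Fin (t + 1)) ω = a i} ∩ {ω | X₂ i ω = b i}) := by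
      ext ω
      simp only [f, Prod.mk.injEq, funext_iff, Set.mem_ofPred_eq, Set.mem_iInter, Set.mem_inter_iff]
      exact forall_and.symm
    rw [this]
    exact MeasurableSet.iInter fun i => (h.meas₁ _ _).inter (h.meas₂ _ _)
  have hB : MeasurableSet {ω | X₁ (t + 1) ω = z' ∧ X₂ (t + 1) ω = w'} :=
    (h.meas₁ _ _).inter (h.meas₂ _ _)
  rw [measure_decomp P f hf _ ((EE_meas h S t z w).inter hB),
    measure_decomp P f hf _ (EE_meas h S t z w), Finset.sum_mul]
  refine Finset.sum_congr rfl ?_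
  rintro ⟨a, b⟩ _
  by_cases hc : (∀ i : Fin (t + 1), (i : ℕ) < t → a i ∉ S ∧ b i ∉ S) ∧
      a (Fin.last t) = z ∧ b (Fin.last t) = w
  · let v : ℕ → V := fun i => if hi : i < t + 1 then a ⟨i, hi⟩ else z'
    let u : ℕ → V := fun i => if hi : i < t + 1 then b ⟨i, hi⟩ else w'
    have hval : ∀ ω, f ω = (a, b) → ∀ i ≤ t, X₁ i ω = v i ∧ X₂ i ω = u i := by
      intro ω hω i hi
      simp only [f, Prod.mk.injEq, funext_iff] at hω
      have hi' : i < t + 1 := by omega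
      simp only [v, u, hi', dif_pos]
      exact ⟨hω.1 ⟨i, hi'⟩, hω.2 ⟨i, hi'⟩⟩
    have hval' : ∀ ω, (∀ i ≤ t, X₁ i ω = v i ∧ X₂ i ω = u i) → f ω = (a, b) := by
      intro ω hω
      simp only [f, Prod.mk.injEq, funext_iff]
      constructor
      · intro i
        have := (hω i (by omega)).1
        simpa [v, Nat.lt_succ_iff.mp i.isLt] using this
      · intro i
        have := (hω i (by omega)).2
        simpa [u, Nat.lt_succ_iff.mp i.isLt] using this
    have hE : ∀ ω, f ω = (a, b) → ω ∈ EE S X₁ X₂ t z w := by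
      intro ω hω
      simp only [f, Prod.mk.injEq, funext_iff] at hω
      refine ⟨fun i hi => ?_, ?_, ?_⟩
      · have := hc.1 ⟨i, by omega⟩ hi
        rw [← hω.1, ← hω.2] at this
        exact this
      · rw [← hc.2.1, ← hω.1]; rfl
      · rw [← hc.2.2, ← hω.2]; rfl
    have e1 : EE S X₁ X₂ t z w ∩ {ω | f ω = (a, b)}
        = {ω | (∀ i ≤ t, X₁ i ω = v i) ∧ ∀ i ≤ t, X₂ i ω = u i} := by
      ext ω
      constructor
      · rintro ⟨_, h2⟩
        exact ⟨fun i hi => (hval ω h2 i hi).1, fun i hi => (hval ω h2 i hi).2⟩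
      · rintro ⟨h1, h2⟩
        have := hval' ω fun i hi => ⟨h1 i hi, h2 i hi⟩
        exact ⟨hE ω this, this⟩
    have hv1 : v (t + 1) = z' := by simp [v]
    have hu1 : u (t + 1) = w' := by simp [u]
    have hv0 : v t = z := by rw [← hc.2.1]; simp [v, Fin.last]
    have hu0 : u t = w := by rw [← hc.2.2]; simp [u, Fin.last]
    have e2 : EE S X₁ X₂ t z w ∩ {ω | X₁ (t + 1) ω = z' ∧ X₂ (t + 1) ω = w'} ∩ {ω | f ω = (a, b)}
        = {ω | (∀ i ≤ t + 1, X₁ i ω = v i) ∧ ∀ i ≤ t + 1, X₂ i ω = u i} := by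
      ext ω
      constructor
      · rintro ⟨⟨_, h3, h4⟩, h2⟩
        constructor
        · intro i hi
          rcases Nat.lt_or_ge t i with hlt | hle
          · obtain rfl : i = t + 1 := by omega
            rw [hv1]; exact h3
          · exact (hval ω h2 i hle).1
        · intro i hi
          rcases Nat.lt_or_ge t i with hlt | hle
          · obtain rfl : i = t + 1 := by omega
            rw [hu1]; exact h4
          · exact (hval ω h2 i hle).2
      · rintro ⟨h1, h2⟩
        have := hval' ω fun i hi => ⟨h1 i (by omega), h2 i (by omega)⟩
        exact ⟨⟨hE ω this, by rw [← hv1]; exact h1 _ le_rfl, by rw [← hu1]; exact h2 _ le_rfl⟩, this⟩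
    rw [e1, e2]
    have l1 := h.law t v u
    have l2 := h.law (t + 1) v u
    simp only [Measure.real]
    rw [l1, l2]
    unfold walkP
    rw [Finset.prod_range_succ, Finset.prod_range_succ, hv0, hu0, hv1, hu1]
    ring
  · have e1 : EE S X₁ X₂ t z w ∩ {ω | f ω = (a, b)} = ∅ := by
      ext ω
      simp only [Set.mem_inter_iff, Set.mem_empty_iff_false, iff_false]
      rintro ⟨⟨h1, h2, h3⟩, h4⟩
      simp only [f, Set.mem_ofPred_eq, Prod.mk.injEq, funext_iff] at h4
      apply hc
      refine ⟨fun i hi => ?_, ?_, ?_⟩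
      · rw [← h4.1, ← h4.2]; exact h1 i hi
      · rw [← h4.1]; exact h2
      · rw [← h4.2]; exact h3
    have e2 : EE S X₁ X₂ t z w ∩ {ω | X₁ (t + 1) ω = z' ∧ X₂ (t + 1) ω = w'} ∩ {ω | f ω = (a, b)}
        = ∅ := by
      rw [Set.inter_right_comm, e1, Set.empty_inter]
    rw [e1, e2]
    simp

theorem EE_prob {G : SimpleGraph V} {P : Measure Ω} [IsProbabilityMeasure P]
    {X₁ X₂ : ℕ → Ω → V}
    (h : IsWalkPair G P X₁ X₂ (uinit V) (uinit V)) (S : Finset V) (t : ℕ) (z w : V) :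
    P.real (EE S X₁ X₂ t z w) = BB G S t z * BB G S t w := by
  induction t generalizing z w with
  | zero =>
    have := h.law 0 (fun _ => z) (fun _ => w)
    simpa [EE, BB, walkP, uinit, Measure.real] using this
  | succ t ih =>
    let f : Ω → V × V := fun ω => (X₁ t ω, X₂ t ω)
    have hf : ∀ i, MeasurableSet {ω | f ω = i} := by
      rintro ⟨a, b⟩
      have : {ω | f ω = (a, b)} = {ω | X₁ t ω = a} ∩ {ω | X₂ t ω = b} := by
        ext ω; simp [f]
      rw [this]
      exact (h.meas₁ _ _).inter (h.meas₂ _ _)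
    rw [measure_decomp P f hf _ (EE_meas h S (t + 1) z w), Fintype.sum_prod_type]
    simp only [BB]
    rw [Finset.sum_mul_sum]
    have key : ∀ a b, P.real (EE S X₁ X₂ (t + 1) z w ∩ {ω | f ω = (a, b)})
        = if a ∉ S ∧ b ∉ S then BB G S t a * K G a z * (BB G S t b * K G b w) else 0 := by
      intro a b
      split_ifs with hab
      · have : EE S X₁ X₂ (t + 1) z w ∩ {ω | f ω = (a, b)}
            = EE S X₁ X₂ t a b ∩ {ω | X₁ (t + 1) ω = z ∧ X₂ (t + 1) ω = w} := by
          ext ω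
          simp only [EE, f, Set.mem_inter_iff, Set.mem_ofPred_eq, Prod.mk.injEq]
          constructor
          · rintro ⟨⟨h1, h2⟩, h3⟩
            exact ⟨⟨fun i hi => h1 i (by omega), h3⟩, h2⟩
          · rintro ⟨⟨h1, h3⟩, h2⟩
            refine ⟨⟨fun i hi => ?_, h2⟩, h3⟩
            rcases Nat.lt_or_ge i t with hlt | hge
            · exact h1 i hlt
            · obtain rfl : i = t := by omega
              rw [h3.1, h3.2]; exact hab
        rw [this, EE_markov h, ih]
        ring
      · have : EE S X₁ X₂ (t + 1) z w ∩ {ω | f ω = (a, b)} = ∅ := by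
          ext ω
          simp only [EE, f, Set.mem_inter_iff, Set.mem_ofPred_eq, Prod.mk.injEq,
            Set.mem_empty_iff_false, iff_false]
          rintro ⟨⟨h1, h2⟩, h3⟩
          apply hab
          rw [← h3.1, ← h3.2]
          exact h1 t (by omega)
        rw [this]; simp
    simp_rw [key]
    rw [← Finset.sum_filter_add_sum_filter_not Finset.univ (fun a => a ∉ S)]
    have z1 : ∑ a ∈ Finset.univ.filter (fun a => ¬ a ∉ S), ∑ b,
        (if a ∉ S ∧ b ∉ S then BB G S t a * K G a z * (BB G S t b * K G b w) else 0) = 0 := by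
      refine Finset.sum_eq_zero fun a ha => Finset.sum_eq_zero fun b _ => ?_
      rw [if_neg]
      intro hh
      exact (Finset.mem_filter.mp ha).2 hh.1
    have z2 : Finset.univ.filter (fun a => a ∉ S) = Sᶜ := by ext; simp
    rw [z1, add_zero, z2]
    refine Finset.sum_congr rfl fun a ha => ?_
    have ha' := Finset.mem_compl.mp ha
    simp only [ha', not_false_eq_true, true_and]
    rw [← Finset.sum_filter, z2]

theorem lt_hitTime {X : ℕ → Ω → V} {x : V} {ω : Ω} (t : ℕ) :
    (t : ℕ∞) < hitTime X x ω ↔ ∀ i ≤ t, X i ω ≠ x := by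
  rw [← not_iff_not]
  push Not
  unfold hitTime
  constructor
  · intro h
    by_contra! hh
    have : ((t + 1 : ℕ) : ℕ∞) ≤ ⨅ (s : ℕ) (_ : X s ω = x), (s : ℕ∞) := by
      refine le_iInf₂ fun s hs => ?_
      have : t + 1 ≤ s := by
        by_contra h'
        exact hh s (by omega) hs
      exact_mod_cast this
    have h2 := this.trans h
    have h3 : t + 1 ≤ t := by exact_mod_cast h2
    omega
  · rintro ⟨i, hi, hx⟩
    exact (iInf₂_le i hx).trans (by exact_mod_cast hi)

theorem hitTime_eq {X : ℕ → Ω → V} {x : V} {ω : Ω} {t : ℕ} (h1 : ∀ i < t, X i ω ≠ x)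
    (h2 : X t ω = x) : hitTime X x ω = t := by
  apply le_antisymm
  · exact iInf₂_le t h2
  · refine le_iInf₂ fun s hs => ?_
    have : t ≤ s := by
      by_contra h'
      exact h1 s (by omega) hs
    exact_mod_cast this

theorem Hevent_eq (X₁ X₂ : ℕ → Ω → V) (x y : V) (hxy : x ≠ y) :
    Hevent X₁ X₂ x y = ⋃ t : ℕ, ⋃ w ∈ ({x, y} : Finset V)ᶜ, EE {x, y} X₁ X₂ t x w := by
  ext ω
  simp only [Hevent, Set.mem_ofPred_eq, lt_min_iff, Set.mem_iUnion]
  constructor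
  · rintro ⟨h1, h2, h3⟩
    have hex : ∃ s, X₁ s ω = x := by
      by_contra! hn
      have : hitTime X₁ x ω = ⊤ := by simp [hitTime, hn]
      rw [this] at h1
      exact not_top_lt h1
    have ht := hitTime_eq (t := Nat.find hex) (fun i hi => Nat.find_min hex hi) (Nat.find_spec hex)
    rw [ht, lt_hitTime] at h1 h2 h3
    refine ⟨Nat.find hex, X₂ (Nat.find hex) ω, ?_, ⟨fun i hi => ?_, Nat.find_spec hex, rfl⟩⟩
    · simp [h2 _ le_rfl, h3 _ le_rfl]
    · have := Nat.find_min hex hi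
      simp [h1 i hi.le, h2 i hi.le, h3 i hi.le, this]
  · rintro ⟨t, w, hw, h1, h2, h3⟩
    simp only [Finset.mem_insert, Finset.mem_singleton, not_or, Finset.mem_compl] at h1 hw
    rw [hitTime_eq (t := t) (fun i hi => (h1 i hi).1.1) h2, lt_hitTime, lt_hitTime, lt_hitTime]
    refine ⟨fun i hi => ?_, fun i hi => ?_, fun i hi => ?_⟩ <;>
      rcases hi.lt_or_eq with hlt | rfl
    · exact (h1 i hlt).1.2
    · rw [h2]; exact hxy
    · exact (h1 i hlt).2.1
    · rw [h3]; exact hw.1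
    · exact (h1 i hlt).2.2
    · rw [h3]; exact hw.2

theorem Hevent_hasSum {G : SimpleGraph V} {P : Measure Ω} [IsProbabilityMeasure P]
    {X₁ X₂ : ℕ → Ω → V}
    (h : IsWalkPair G P X₁ X₂ (uinit V) (uinit V)) (x y : V) (hxy : x ≠ y) :
    HasSum (fun t => BB G {x, y} t x * QQ G {x, y} t) (P (Hevent X₁ X₂ x y)).toReal := by
  set D : ℕ → Set Ω := fun t => ⋃ w ∈ ({x, y} : Finset V)ᶜ, EE {x, y} X₁ X₂ t x w with hD
  have hDm : ∀ t, MeasurableSet (D t) := fun t =>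
    Finset.measurableSet_biUnion _ fun w _ => EE_meas h _ t x w
  have hdis : Pairwise (Function.onFun Disjoint D) := by
    have aux : ∀ s t, s < t → Disjoint (D s) (D t) := by
      intro s t hst
      refine Set.disjoint_left.mpr fun ω h1 h2 => ?_
      simp only [hD, Set.mem_iUnion] at h1 h2
      obtain ⟨w, _, _, h1, _⟩ := h1
      obtain ⟨w', _, h2, _⟩ := h2
      exact (h2 s hst).1 (by simp [h1])
    intro s t hst
    rcases lt_or_gt_of_ne hst with h | h
    · exact aux s t h
    · exact (aux t s h).symm
  have hDp : ∀ t, (P (D t)).toReal = BB G {x, y} t x * QQ G {x, y} t := by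
    intro t
    have : P.real (D t) = ∑ w ∈ ({x, y} : Finset V)ᶜ, P.real (EE {x, y} X₁ X₂ t x w) := by
      refine measureReal_biUnion_finset ?_ fun w _ => EE_meas h _ t x w
      intro a _ b _ hab
      refine Set.disjoint_left.mpr ?_
      rintro ω ⟨_, _, h1⟩ ⟨_, _, h2⟩
      exact hab (h1.symm.trans h2)
    change P.real (D t) = _
    rw [this, QQ, Finset.mul_sum]
    exact Finset.sum_congr rfl fun w _ => EE_prob h _ t x w
  have hU : P (Hevent X₁ X₂ x y) = ∑' t, P (D t) := by
    rw [Hevent_eq X₁ X₂ x y hxy, measure_iUnion hdis hDm]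
  have hne : ∑' t, P (D t) ≠ ⊤ := by rw [← hU]; exact measure_ne_top _ _
  rw [hU, ENNReal.tsum_toReal_eq fun t => measure_ne_top _ _]
  simp_rw [← hDp]
  exact (ENNReal.summable_toReal hne).hasSum

end Helpers

/-- Lemma 12. Under Assumption 1, uniformly in distinct
`x, y`, `P[H(x,y)] = 1/4 + o(Υ_n/log|V_n|) + O(1/|V_n|)`. -/
theorem Hevent_prob_quarter
    (V : ℕ → Type) [∀ n, Fintype (V n)] (G : ∀ n, SimpleGraph (V n))
    (hA : Assumption1 V G)
    (Ω : ℕ → Type) [∀ n, MeasurableSpace (Ω n)]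
    (P : ∀ n, Measure (Ω n)) (hP : ∀ n, IsProbabilityMeasure (P n))
    (X₁ X₂ : ∀ n, ℕ → Ω n → V n)
    (hsetup : ∀ n, IsWalkPair (G n) (P n) (X₁ n) (X₂ n) (uinit (V n)) (uinit (V n))) :
    ∃ C > (0 : ℝ), ∃ ε : ℕ → ℝ, Tendsto ε atTop (nhds 0) ∧
      ∀ n, ∀ x y : V n, x ≠ y →
        |(P n (Hevent (X₁ n) (X₂ n) x y)).toReal - 1 / 4|
          ≤ ε n * ((Tmix (G n) : ℝ) / (Fintype.card (V n) : ℝ))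
              / Real.log (Fintype.card (V n))
            + C / (Fintype.card (V n) : ℝ) := by
  refine ⟨1, one_pos, fun _ => 0, tendsto_const_nhds, fun n x y hxy => ?_⟩
  haveI := hP n
  have := limit_bound (G n) (hA.conn n) (hA.vt n) x y hxy _ (Hevent_hasSum (hsetup n) x y hxy)
  simpa using this

end RWPaint
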